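/- With the same setup, the intersection over m = 1,…,2g+1 of the kernels of C_{a_m} : ⋀^2 V → ⋀^2 V equals the span of δ = Σ_{i=1}^g v_i∧w_i together with all w_i ∧ w_j for 1 ≤ i < j ≤ g; in particular this intersection has dimension C(g,2) + 1. -/

import Mathlib

noncomputable section

/-- The `2g`-dimensional vector space `V` with basis `v₁,…,v_g, w₁,…,w_g`. -/
abbrev Vg (K : Type*) (g : ℕ) := (Fin g ⊕ Fin g) → K

variable {K : Type*} [Field K]

def vv (g : ℕ) (i : Fin g) : Vg K g := Pi.single (Sum.inl i) 1

def ww (g : ℕ) (i : Fin g) : Vg K g := Pi.single (Sum.inr i) 1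

def Kvec (g : ℕ) (a : K) : Vg K g := Sum.elim (fun _ => 0) (fun k => a ^ (k : ℕ))

def Lfun (g : ℕ) (a : K) : Vg K g →ₗ[K] K :=
  ∑ k : Fin g, a ^ (k : ℕ) • (LinearMap.proj (Sum.inl k) : Vg K g →ₗ[K] K)

/-- `C_a(v) = L_a(v)·K_a` -/
def Cmap (g : ℕ) (a : K) : Vg K g →ₗ[K] Vg K g := (Lfun g a).smulRight (Kvec g a)

/-- `δ = Σ_i v_i ∧ w_i` -/
def deltaE (g : ℕ) : ExteriorAlgebra K (Vg K g) :=
  ∑ i, ExteriorAlgebra.ι K (vv g i) * ExteriorAlgebra.ι K (ww g i)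

open ExteriorAlgebra in
/-- The Plücker coordinate on the exterior algebra of `n → K` attached to a pair of indices: it
sends `x ∧ y` to `x s * y t - x t * y s` and vanishes in every degree other than two. -/
def pluckerCoord {n : Type*} (s t : n) : ExteriorAlgebra K (n → K) →ₗ[K] K :=
  liftAlternating (Pi.single (M := fun i => (n → K) [⋀^Fin i]→ₗ[K] K) 2
    (Matrix.detRowAlternating.compLinearMap (LinearMap.funLeft K K ![s, t])))

open ExteriorAlgebra in
theorem pluckerCoord_ι_mul_ι {n : Type*} (s t : n) (x y : n → K) :
    pluckerCoord s t (ι K x * ι K y) = x s * y t - x t * y s := by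
  have h : ι K x * ι K y = ιMulti K 2 ![x, y] := by simp [ιMulti_apply]
  rw [h, pluckerCoord, liftAlternating_apply_ιMulti, Pi.single_eq_same]
  refine (Matrix.det_fin_two _).trans ?_
  simp [LinearMap.funLeft]

/-- Linear maps agreeing on products of two vectors agree on the degree two part. -/
theorem ExteriorAlgebra.eqOn_range_ι_sq {V N : Type*} [AddCommGroup V] [Module K V]
    [AddCommGroup N] [Module K N] {f h : ExteriorAlgebra K V →ₗ[K] N}
    (H : ∀ x y, f (ι K x * ι K y) = h (ι K x * ι K y)) {z : ExteriorAlgebra K V}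
    (hz : z ∈ LinearMap.range (ι K : V →ₗ[K] ExteriorAlgebra K V) ^ 2) : f z = h z := by
  rw [pow_two] at hz
  refine Submodule.mul_induction_on hz ?_ fun x y hx hy => by rw [map_add, map_add, hx, hy]
  rintro _ ⟨x, rfl⟩ _ ⟨y, rfl⟩
  exact H x y

open ExteriorAlgebra in
/-- The expansion of a bivector in the basis of products of standard basis vectors, the indices
being ordered by a strict total order `r`. -/
theorem sum_pluckerCoord_smul {n : Type*} [Fintype n] [DecidableEq n] (r : n → n → Prop)
    [DecidableRel r] [IsStrictTotalOrder n r] {z : ExteriorAlgebra K (n → K)}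
    (hz : z ∈ LinearMap.range (ι K : (n → K) →ₗ[K] ExteriorAlgebra K (n → K)) ^ 2) :
    z = ∑ s, ∑ t, if r s t then
      pluckerCoord s t z • (ι K (Pi.single s 1) * ι K (Pi.single t 1)) else 0 := by
  let Φ : ExteriorAlgebra K (n → K) →ₗ[K] ExteriorAlgebra K (n → K) :=
    ∑ s, ∑ t, if r s t then
      (pluckerCoord s t).smulRight (ι K (Pi.single s 1) * ι K (Pi.single t 1)) else 0
  have hΦ (x) : Φ x = ∑ s, ∑ t, if r s t then
      pluckerCoord s t x • (ι K (Pi.single s 1) * ι K (Pi.single t 1)) else 0 := by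
    simp only [Φ, LinearMap.sum_apply]
    refine Finset.sum_congr rfl fun s _ => Finset.sum_congr rfl fun t _ => ?_
    split_ifs <;> simp
  have hB : (LinearMap.mul K _).compl₁₂ (ι K) (ι K) =
      ((LinearMap.mul K _).compl₁₂ (ι K) (ι K)).compr₂ Φ := by
    refine LinearMap.ext_basis (Pi.basisFun K n) (Pi.basisFun K n) fun a b => ?_
    simp only [LinearMap.compl₁₂_apply, LinearMap.compr₂_apply, LinearMap.mul_apply', hΦ,
      pluckerCoord_ι_mul_ι, Pi.basisFun_apply]
    let e (s : n) : ExteriorAlgebra K (n → K) := ι K (Pi.single s 1)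
    have hterm (s t : n) : (if r s t then
        ((Pi.single a 1 : n → K) s * (Pi.single b 1 : n → K) t
          - (Pi.single a 1 : n → K) t * (Pi.single b 1 : n → K) s) • (e s * e t) else 0) =
        (if s = a then if t = b then if r a b then e a * e b else 0 else 0 else 0)
        - (if s = b then if t = a then if r b a then e b * e a else 0 else 0 else 0) := by
      simp only [Pi.single_apply]
      split_ifs <;> simp_all
    simp only [e] at hterm
    simp only [hterm, Finset.sum_sub_distrib, Finset.sum_ite_eq', Finset.mem_univ, if_true,
      Finset.sum_ite_irrel, Finset.sum_const_zero]
    rcases trichotomous_of r a b with h | rfl | h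
    · simp [h, asymm_of r h]
    · simp
    · simp only [h, asymm_of r h, if_true, if_false, zero_sub]
      exact eq_neg_of_add_eq_zero_left (ι_add_mul_swap _ _)
  rw [← hΦ]
  exact eqOn_range_ι_sq (f := LinearMap.id) (h := Φ)
    (fun x y => LinearMap.congr_fun (LinearMap.congr_fun hB x) y) hz

theorem Lfun_apply (g : ℕ) (a : K) (x : Vg K g) :
    Lfun g a x = ∑ k : Fin g, a ^ (k : ℕ) * x (Sum.inl k) := by
  simp [Lfun]

theorem Cmap_vv (g : ℕ) (a : K) (i : Fin g) : Cmap g a (vv g i) = a ^ (i : ℕ) • Kvec g a := by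
  simp [Cmap, Lfun_apply, vv, Pi.single_apply]

theorem Cmap_ww (g : ℕ) (a : K) (i : Fin g) : Cmap g a (ww g i) = 0 := by
  simp [Cmap, Lfun_apply, ww]

theorem Kvec_eq_sum (g : ℕ) (a : K) : Kvec g a = ∑ i : Fin g, a ^ (i : ℕ) • ww g i := by
  ext (j | j) <;> simp [Kvec, ww, Finset.sum_apply, Pi.single_apply]

section Derivation

open ExteriorAlgebra

variable {g : ℕ} {a : K} {D : ExteriorAlgebra K (Vg K g) →ₗ[K] ExteriorAlgebra K (Vg K g)}

theorem map_deltaE_eq_zero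
    (hD : ∀ x y, D (ι K x * ι K y) = ι K (Cmap g a x) * ι K y + ι K x * ι K (Cmap g a y)) :
    D (deltaE g) = 0 := by
  have h : D (deltaE g) = ι K (Kvec g a) * ι K (∑ i : Fin g, a ^ (i : ℕ) • ww g i) := by
    simp [deltaE, hD, Cmap_vv, Cmap_ww, Finset.mul_sum]
  rw [h, ← Kvec_eq_sum, ι_sq_zero]

theorem pluckerCoord_map
    (hD : ∀ x y, D (ι K x * ι K y) = ι K (Cmap g a x) * ι K y + ι K x * ι K (Cmap g a y))
    (s t : Fin g ⊕ Fin g) {z : ExteriorAlgebra K (Vg K g)}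
    (hz : z ∈ LinearMap.range (ι K : Vg K g →ₗ[K] ExteriorAlgebra K (Vg K g)) ^ 2) :
    pluckerCoord s t (D z) =
      Kvec g a s * ∑ i : Fin g, a ^ (i : ℕ) * pluckerCoord (Sum.inl i) t z
      - Kvec g a t * ∑ i : Fin g, a ^ (i : ℕ) * pluckerCoord (Sum.inl i) s z := by
  have key := eqOn_range_ι_sq (f := pluckerCoord s t ∘ₗ D)
    (h := Kvec g a s • ∑ i : Fin g, a ^ (i : ℕ) • pluckerCoord (Sum.inl i) t
      - Kvec g a t • ∑ i : Fin g, a ^ (i : ℕ) • pluckerCoord (Sum.inl i) s) (fun x y => ?_) hz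
  · simpa using key
  · have hL (u : Fin g ⊕ Fin g) : ∑ i : Fin g, a ^ (i : ℕ) *
        (x (Sum.inl i) * y u - x u * y (Sum.inl i)) = Lfun g a x * y u - x u * Lfun g a y := by
      simp only [Lfun_apply, Finset.sum_mul, Finset.mul_sum, ← Finset.sum_sub_distrib]
      exact Finset.sum_congr rfl fun i _ => by ring
    simp only [LinearMap.comp_apply, hD, map_add, pluckerCoord_ι_mul_ι, LinearMap.sub_apply,
      LinearMap.smul_apply, LinearMap.sum_apply, smul_eq_mul, hL, Cmap,
      LinearMap.smulRight_apply, Pi.smul_apply]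
    ring

end Derivation

open Polynomial in
/-- Polynomials of degree less than `g` satisfying `P l = X ^ l * P 0` at sufficiently many points
are the multiples `c * X ^ l`. -/
theorem coeff_eq_ite_of_eval_eq {g N : ℕ} (hN : 2 * g ≤ N) (hg : 1 ≤ g) {a : Fin N → K}
    (ha : Function.Injective a) (q : Fin g → Fin g → K)
    (H : ∀ m, ∀ l : Fin g, ∑ i : Fin g, a m ^ (i : ℕ) * q i l
      = a m ^ (l : ℕ) * ∑ i : Fin g, a m ^ (i : ℕ) * q i ⟨0, hg⟩) (i l : Fin g) :
    q i l = if i = l then q ⟨0, hg⟩ ⟨0, hg⟩ else 0 := by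
  let P (l : Fin g) : K[X] := ∑ i : Fin g, C (q i l) * X ^ (i : ℕ)
  have hcoeff (l : Fin g) (k : ℕ) :
      (P l).coeff k = if h : k < g then q ⟨k, h⟩ l else 0 := by
    simp only [P, finsetSum_coeff, coeff_C_mul, coeff_X_pow, mul_ite, mul_one, mul_zero]
    split_ifs with h
    · rw [Finset.sum_eq_single ⟨k, h⟩] <;> simp +contextual [Fin.ext_iff, eq_comm]
    · exact Finset.sum_eq_zero fun i _ => if_neg (by have := i.2; omega)
  have hdeg (l : Fin g) : (P l).natDegree < g := by
    have h : (P l).natDegree ≤ g - 1 := natDegree_le_iff_coeff_eq_zero.2 fun k hk => by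
      rw [hcoeff, dif_neg (by omega)]
    omega
  have hP (l : Fin g) : P l = X ^ (l : ℕ) * P ⟨0, hg⟩ := by
    rw [← sub_eq_zero]
    refine eq_zero_of_natDegree_lt_card_of_eval_eq_zero _ ha (fun m => ?_) ?_
    · simp only [P, eval_sub, eval_mul, eval_finsetSum, eval_C, eval_pow, eval_X, sub_eq_zero,
        mul_comm (q _ _)]
      exact H m l
    · rw [Fintype.card_fin]
      refine lt_of_le_of_lt (natDegree_sub_le _ _) (max_lt (by have := hdeg l; omega) ?_)
      have h₁ := natDegree_mul_le (p := (X : K[X]) ^ (l : ℕ)) (q := P ⟨0, hg⟩)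
      have h₂ := hdeg ⟨0, hg⟩
      have h₃ := l.2
      rw [natDegree_X_pow] at h₁
      omega
  have hzero (k : ℕ) (hk : k ≠ 0) : (P ⟨0, hg⟩).coeff k = 0 := by
    rw [← coeff_X_pow_mul _ (g - 1), ← hP ⟨g - 1, by omega⟩, hcoeff, dif_neg (by omega)]
  have hq : q i l = (X ^ (l : ℕ) * P ⟨0, hg⟩).coeff i := by
    rw [← hP, hcoeff, dif_pos i.2]
  rw [hq, coeff_X_pow_mul']
  split_ifs with h₁ h₂ h₂
  · subst h₂
    rw [Nat.sub_self, hcoeff, dif_pos (Nat.pos_of_ne_zero (by omega))]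
  · exact hzero _ (by have := Fin.val_ne_of_ne h₂; omega)
  · exact absurd h₂.ge h₁
  · rfl

open ExteriorAlgebra in
/-- A bivector with no `v ∧ v` part and with scalar `v ∧ w` part is a combination of `δ` and the
`w ∧ w`. -/
theorem mem_span_deltaE {g : ℕ} {z : ExteriorAlgebra K (Vg K g)}
    (hz : z ∈ LinearMap.range (ι K : Vg K g →ₗ[K] ExteriorAlgebra K (Vg K g)) ^ 2)
    (hvv : ∀ i j : Fin g, pluckerCoord (Sum.inl i) (Sum.inl j) z = 0) {c : K}
    (hvw : ∀ i j : Fin g, pluckerCoord (Sum.inl i) (Sum.inr j) z = if i = j then c else 0) :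
    z ∈ Submodule.span K (insert (deltaE g) {x | ∃ i j : Fin g, i < j ∧
      x = ι K (ww g i) * ι K (ww g j)}) := by
  have hsum : z = c • deltaE g + ∑ i : Fin g, ∑ j : Fin g, if i < j then
      pluckerCoord (Sum.inr i) (Sum.inr j) z • (ι K (ww g i) * ι K (ww g j)) else 0 := by
    conv_lhs => rw [sum_pluckerCoord_smul (Sum.Lex (· < ·) (· < ·)) hz]
    simp [Fintype.sum_sum_type, hvv, hvw, deltaE, vv, ww, Finset.smul_sum]
  rw [hsum]
  refine add_mem (Submodule.smul_mem _ _ (Submodule.subset_span (Set.mem_insert _ _)))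
    (sum_mem fun i _ => sum_mem fun j _ => ?_)
  split_ifs with h
  · exact Submodule.smul_mem _ _ (Submodule.subset_span (Set.mem_insert_of_mem _ ⟨i, j, h, rfl⟩))
  · exact zero_mem _

open ExteriorAlgebra in
theorem finrank_span_deltaE {g : ℕ} (hg : 1 ≤ g) :
    Module.finrank K (Submodule.span K (insert (deltaE g : ExteriorAlgebra K (Vg K g))
      {x | ∃ i j : Fin g, i < j ∧ x = ι K (ww g i) * ι K (ww g j)})) = g.choose 2 + 1 := by
  let b : Option (Σ j : Fin g, {i : Fin g // i < j}) → ExteriorAlgebra K (Vg K g) :=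
    fun o => o.elim (deltaE g) fun p => ι K (ww g p.2) * ι K (ww g p.1)
  let f : Option (Σ j : Fin g, {i : Fin g // i < j}) → Module.Dual K (ExteriorAlgebra K (Vg K g)) :=
    fun o => o.elim (pluckerCoord (Sum.inl ⟨0, hg⟩) (Sum.inr ⟨0, hg⟩))
      fun p => pluckerCoord (Sum.inr p.2.1) (Sum.inr p.1)
  have hrange : insert (deltaE g) {x | ∃ i j : Fin g, i < j ∧ x = ι K (ww g i) * ι K (ww g j)}
      = Set.range b := by
    ext x
    simp only [Set.mem_insert_iff, Set.mem_ofPred_eq, Set.mem_range, Option.exists, b]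
    refine or_congr eq_comm ⟨?_, ?_⟩
    · rintro ⟨i, j, h, rfl⟩
      exact ⟨⟨j, i, h⟩, rfl⟩
    · rintro ⟨⟨j, i, h⟩, rfl⟩
      exact ⟨i, j, h, rfl⟩
  have hb : LinearIndependent K b := by
    refine LinearIndependent.of_pairwise_dual_eq_zero_one b f ?_ ?_
    · rintro (_ | ⟨j, i, h⟩) (_ | ⟨l, k, h'⟩) hne
      · exact absurd rfl hne
      · simp [f, b, pluckerCoord_ι_mul_ι, ww]
      · simp [f, b, pluckerCoord_ι_mul_ι, deltaE, vv]
      · have hne' : ¬(i = k ∧ j = l) := by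
          rintro ⟨rfl, rfl⟩
          exact hne rfl
        have hswap : ¬(j = k ∧ i = l) := by
          rintro ⟨rfl, rfl⟩
          exact lt_asymm h h'
        simp only [f, b, Option.elim, pluckerCoord_ι_mul_ι, ww, Pi.single_apply, Sum.inr.injEq,
          ← ite_and, mul_ite, mul_one, mul_zero]
        grind
    · rintro (_ | ⟨j, i, h⟩)
      · simp [f, b, pluckerCoord_ι_mul_ι, deltaE, vv, ww, Pi.single_apply]
      · simp [f, b, pluckerCoord_ι_mul_ι, ww, h.ne, h.ne']
  rw [hrange, finrank_span_eq_card hb, Fintype.card_option, Fintype.card_sigma]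
  have hcard (j : Fin g) : Fintype.card {i : Fin g // i < j} = j := by
    rw [Fintype.card_subtype, Finset.filter_gt_eq_Iio, Fin.card_Iio]
  simp only [hcard]
  rw [Fin.sum_univ_eq_sum_range (fun j => j), Finset.sum_range_id, Nat.choose_two_right]

/-- the intersection with `⋀² V` of the kernels of the derivation
extensions of `C_{a_m}` (for `2g+1` pairwise distinct scalars `a_m`) equals the span of
`δ = Σ_i v_i ∧ w_i` together with all `w_i ∧ w_j`, `i < j`; in particular it has
dimension `C(g,2) + 1`. -/
theorem ker_p_curvature_wedge_two (g : ℕ) (hg : 1 ≤ g)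
    (a : Fin (2 * g + 1) → K) (ha : Function.Injective a)
    (D : Fin (2 * g + 1) → (ExteriorAlgebra K (Vg K g) →ₗ[K] ExteriorAlgebra K (Vg K g)))
    (hD : ∀ m, ∀ x y : Vg K g,
      D m (ExteriorAlgebra.ι K x * ExteriorAlgebra.ι K y)
        = ExteriorAlgebra.ι K (Cmap g (a m) x) * ExteriorAlgebra.ι K y
          + ExteriorAlgebra.ι K x * ExteriorAlgebra.ι K (Cmap g (a m) y)) :
    ((LinearMap.range
        (ExteriorAlgebra.ι K : Vg K g →ₗ[K] ExteriorAlgebra K (Vg K g))) ^ 2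
      ⊓ ⨅ m, LinearMap.ker (D m))
      = Submodule.span K
          (insert (deltaE g)
            {x : ExteriorAlgebra K (Vg K g) | ∃ i j : Fin g, i < j ∧
              x = ExteriorAlgebra.ι K (ww g i) * ExteriorAlgebra.ι K (ww g j)})
    ∧ Module.finrank K
        ↥((LinearMap.range
            (ExteriorAlgebra.ι K : Vg K g →ₗ[K] ExteriorAlgebra K (Vg K g))) ^ 2
          ⊓ ⨅ m, LinearMap.ker (D m))
        = g.choose 2 + 1 := by
  have hspan : ((LinearMap.range
        (ExteriorAlgebra.ι K : Vg K g →ₗ[K] ExteriorAlgebra K (Vg K g))) ^ 2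
      ⊓ ⨅ m, LinearMap.ker (D m))
      = Submodule.span K
          (insert (deltaE g)
            {x : ExteriorAlgebra K (Vg K g) | ∃ i j : Fin g, i < j ∧
              x = ExteriorAlgebra.ι K (ww g i) * ExteriorAlgebra.ι K (ww g j)}) := by
    have hmem (x y : Vg K g) : ExteriorAlgebra.ι K x * ExteriorAlgebra.ι K y ∈
        (LinearMap.range (ExteriorAlgebra.ι K : Vg K g →ₗ[K] ExteriorAlgebra K (Vg K g))) ^ 2 := by
      rw [pow_two]
      exact Submodule.mul_mem_mul ⟨x, rfl⟩ ⟨y, rfl⟩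
    apply le_antisymm
    · rintro z ⟨hz, hker⟩
      have hDz (m) : D m z = 0 := (Submodule.mem_iInf _).1 hker m
      have hcoord (m) (t : Fin g ⊕ Fin g) := pluckerCoord_map (hD m) (Sum.inr ⟨0, hg⟩) t hz
      simp only [hDz, map_zero] at hcoord
      refine mem_span_deltaE hz (fun i j => ?_)
        (coeff_eq_ite_of_eval_eq (Nat.le_succ _) hg ha
          (fun i l => pluckerCoord (Sum.inl i) (Sum.inr l) z) fun m l => ?_)
      · have hle : g ≤ 2 * g + 1 := by omega
        refine congrFun (Matrix.eq_zero_of_forall_index_sum_pow_mul_eq_zero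
          (ha.comp (Fin.castLE_injective hle))
          (v := fun i => pluckerCoord (Sum.inl i) (Sum.inl j) z) fun m => ?_) i
        simpa [Kvec] using (hcoord (Fin.castLE hle m) (Sum.inl j)).symm
      · have h := hcoord m (Sum.inr l)
        simp only [Kvec, Sum.elim_inr, pow_zero, one_mul] at h
        exact sub_eq_zero.1 h.symm
    · refine Submodule.span_le.2 (Set.insert_subset ?_ ?_)
      · exact ⟨sum_mem fun i _ => hmem _ _,
          (Submodule.mem_iInf _).2 fun m => map_deltaE_eq_zero (hD m)⟩
      · rintro _ ⟨i, j, -, rfl⟩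
        refine ⟨hmem _ _, (Submodule.mem_iInf _).2 fun m => ?_⟩
        simp [hD, Cmap_ww]
  exact ⟨hspan, hspan ▸ finrank_span_deltaE hg⟩
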